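/- Let A be an N×N positive definite Hermitian complex matrix, let a > 0, and suppose that A has exactly k eigenvalues, counted with multiplicity, in the interval [a, ∞), where k ≥ 1. Then there exists an index subset α ⊆ {1,…,N} of cardinality k such that the k×k matrix A[α] − (a/(k!·2^{k−1}·N))·I_k is positive semidefinite. -/

import Mathlib

open Matrix
open scoped ComplexOrder

lemma aux_dot {ι : Type*} [Fintype ι] (x : ι → ℂ) :
    star x ⬝ᵥ x = ((∑ i, ‖x i‖ ^ 2 : ℝ) : ℂ) := by
  simp only [dotProduct, Pi.star_apply, RCLike.star_def, Complex.ofReal_sum]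
  refine Finset.sum_congr rfl fun i _ => ?_
  rw [Complex.conj_mul']; simp

lemma aux_exists {N k : ℕ} (V : Matrix (Fin N) (Fin k) ℂ) (hV : Vᴴ * V = 1) :
    ∃ s : Fin k → Fin N, (V.submatrix s id).det ≠ 0 := by
  by_contra! h
  have h1 : (Vᴴ * V).det = 0 := by
    have e : (Vᴴ * V) = fun i => ∑ j : Fin N, (Vᴴ i j) • V j := by
      ext i l
      simp [Matrix.mul_apply, Finset.sum_apply]
    rw [e]
    change (detRowAlternating (R := ℂ) (n := Fin k)).toMultilinearMap
      (fun i => ∑ j : Fin N, (Vᴴ i j) • V j) = 0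
    rw [MultilinearMap.map_sum]
    refine Finset.sum_eq_zero fun r _ => ?_
    rw [MultilinearMap.map_smul_univ]
    have := h r
    change (detRowAlternating (R := ℂ) (n := Fin k)).toMultilinearMap (fun i => V (r i)) = 0 at this
    rw [this, smul_zero]
  rw [hV] at h1
  simp at h1

lemma aux_main {N k : ℕ} (V : Matrix (Fin N) (Fin k) ℂ) (hV : Vᴴ * V = 1)
    (c : ℝ) (hc0 : 0 ≤ c) (hc : c * (k * N) ≤ 1) :
    ∃ s : Fin k → Fin N, Function.Injective s ∧
      ((V.submatrix s id) * (V.submatrix s id)ᴴ - (c : ℝ) • (1 : Matrix (Fin k) (Fin k) ℂ)).PosSemidef := by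
  obtain ⟨s₀, hs₀⟩ := aux_exists V hV
  have : Nonempty (Fin k → Fin N) := ⟨s₀⟩
  obtain ⟨s, hs⟩ := Finite.exists_max (fun s : Fin k → Fin N => ‖(V.submatrix s id).det‖)
  have hdet : (V.submatrix s id).det ≠ 0 := by
    have := hs s₀
    have h2 := norm_pos_iff.mpr hs₀
    exact norm_pos_iff.mp (lt_of_lt_of_le h2 this)
  refine ⟨s, ?_, ?_⟩
  · intro i j hij
    by_contra hne
    exact hdet (Matrix.det_zero_of_row_eq hne (by ext l; simp [hij]))
  set W := V.submatrix s id with hW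
  have hu : IsUnit W.det := isUnit_iff_ne_zero.mpr hdet
  set B := V * W⁻¹ with hB
  have hBW : B * W = V := by
    rw [hB, Matrix.mul_assoc, Matrix.nonsing_inv_mul _ hu, Matrix.mul_one]
  have hB1 : ∀ i j, ‖B i j‖ ≤ 1 := by
    intro i j
    have e : V.submatrix (Function.update s j i) id = W.updateRow j (∑ l, B i l • W l) := by
      ext p q
      by_cases hp : p = j
      · subst hp
        have := congrFun (congrFun hBW i) q
        simp [← this, Matrix.mul_apply, Finset.sum_apply]
      · simp [hp, hW]
    have h2 := hs (Function.update s j i)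
    simp only [e, det_updateRow_sum, smul_eq_mul, norm_mul] at h2
    have h3 := norm_pos_iff.mpr hdet
    exact le_of_mul_le_mul_right (by simpa using h2) h3
  refine PosSemidef.of_dotProduct_mulVec_nonneg ?_ ?_
  · refine IsHermitian.sub (isHermitian_mul_conjTranspose_self W) ?_
    unfold IsHermitian
    simp [conjTranspose_smul]
  intro x
  set y := Wᴴ *ᵥ x with hy
  set z := V *ᵥ y with hz
  have hzy : ∑ i, ‖z i‖ ^ 2 = ∑ i, ‖y i‖ ^ 2 := by
    have h : star z ⬝ᵥ z = star y ⬝ᵥ y := by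
      rw [hz, star_mulVec, ← dotProduct_mulVec, mulVec_mulVec, hV, one_mulVec]
    rw [aux_dot, aux_dot] at h
    exact_mod_cast h
  have hx : x = Bᴴ *ᵥ z := by
    rw [hz, mulVec_mulVec, hB, conjTranspose_mul, Matrix.mul_assoc, hV, Matrix.mul_one, hy,
      mulVec_mulVec, ← conjTranspose_mul, Matrix.mul_nonsing_inv _ hu]
    simp
  have hxj : ∀ j, ‖x j‖ ^ 2 ≤ N * ∑ i, ‖z i‖ ^ 2 := by
    intro j
    have h1 : ‖x j‖ ≤ ∑ i, ‖z i‖ := by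
      have hxs : x j = ∑ i, Bᴴ j i * z i := congrFun hx j
      rw [hxs]
      refine (norm_sum_le _ _).trans (Finset.sum_le_sum fun i _ => ?_)
      simp only [norm_mul, conjTranspose_apply, norm_star]
      exact mul_le_of_le_one_left (norm_nonneg _) (hB1 i j)
    calc ‖x j‖ ^ 2 ≤ (∑ i, ‖z i‖) ^ 2 := by gcongr
      _ ≤ _ := by simpa using sq_sum_le_card_mul_sum_sq (s := Finset.univ) (f := fun i => ‖z i‖)
  have hxx : ∑ j, ‖x j‖ ^ 2 ≤ (k * N) * ∑ i, ‖y i‖ ^ 2 := by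
    rw [← hzy]
    refine (Finset.sum_le_sum fun j _ => hxj j).trans ?_
    simp [mul_assoc]
  have hval : star x ⬝ᵥ (W * Wᴴ - c • (1 : Matrix (Fin k) (Fin k) ℂ)) *ᵥ x
      = ((∑ i, ‖y i‖ ^ 2 - c * ∑ j, ‖x j‖ ^ 2 : ℝ) : ℂ) := by
    rw [sub_mulVec, dotProduct_sub, smul_mulVec, one_mulVec, dotProduct_smul, aux_dot,
      ← mulVec_mulVec, dotProduct_mulVec]
    have : star x ᵥ* W = star y := by rw [hy, star_mulVec, conjTranspose_conjTranspose]
    rw [this, ← hy, aux_dot]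
    simp
  rw [hval]
  have hY : 0 ≤ ∑ i, ‖y i‖ ^ 2 := by positivity
  have : c * ∑ j, ‖x j‖ ^ 2 ≤ ∑ i, ‖y i‖ ^ 2 := by
    calc _ ≤ c * ((k * N) * ∑ i, ‖y i‖ ^ 2) := by gcongr
      _ = (c * (k * N)) * ∑ i, ‖y i‖ ^ 2 := by ring
      _ ≤ _ := mul_le_of_le_one_left hY hc
  exact_mod_cast sub_nonneg.mpr this

theorem stmt4 {N : ℕ} (A : Matrix (Fin N) (Fin N) ℂ) (hA : A.PosDef)
    (a : ℝ) (ha : 0 < a) (k : ℕ) (hk : 1 ≤ k)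
    (hcount : Nat.card {i : Fin N // hA.1.eigenvalues i ∈ Set.Ici a} = k) :
    ∃ (α : Finset (Fin N)) (hα : α.card = k),
      (A.submatrix (fun i => ((α.orderIsoOfFin hα) i : Fin N))
          (fun j => ((α.orderIsoOfFin hα) j : Fin N)) -
        (a / (k.factorial * 2 ^ (k - 1) * N) : ℝ) •
          (1 : Matrix (Fin k) (Fin k) ℂ)).PosSemidef := by
  classical
  let e : {i : Fin N // hA.1.eigenvalues i ∈ Set.Ici a} ≃ Fin k := Finite.equivFinOfCardEq hcount
  set U : Matrix (Fin N) (Fin N) ℂ :=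
    (hA.1.eigenvectorUnitary : Matrix (Fin N) (Fin N) ℂ) with hU
  have hUU : Uᴴ * U = 1 := by
    have := Unitary.coe_star_mul_self hA.1.eigenvectorUnitary
    simpa [star_eq_conjTranspose] using this
  let V : Matrix (Fin N) (Fin k) ℂ := U.submatrix id (fun t => (e.symm t : Fin N))
  have hV : Vᴴ * V = 1 := by
    have : Vᴴ * V = (Uᴴ * U).submatrix (fun t => (e.symm t : Fin N)) (fun t => (e.symm t : Fin N)) := by
      ext i j
      simp [V, Matrix.mul_apply]
    rw [this, hUU]
    exact submatrix_one _ (Subtype.val_injective.comp e.symm.injective)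
  have hVV : V * Vᴴ = U * diagonal (fun i => if a ≤ hA.1.eigenvalues i then (1 : ℂ) else 0) * Uᴴ := by
    ext i j
    rw [Matrix.mul_apply, Matrix.mul_apply]
    simp only [mul_diagonal, V, submatrix_apply, conjTranspose_apply, id]
    rw [← e.sum_comp]
    simp only [Equiv.symm_apply_apply, mul_ite, mul_one, mul_zero, ite_mul, zero_mul]
    rw [← Finset.sum_filter]
    exact (Finset.sum_subtype (Finset.univ.filter fun l => a ≤ hA.1.eigenvalues l) (by simp)
      (fun l => U i l * star (U j l))).symm
  have hAU : A = U * diagonal (fun i => (hA.1.eigenvalues i : ℂ)) * Uᴴ := by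
    have := hA.1.spectral_theorem
    rw [Unitary.conjStarAlgAut_apply] at this
    exact this
  have hpsd : (A - a • (V * Vᴴ)).PosSemidef := by
    have : A - a • (V * Vᴴ) = U * diagonal (fun i => (hA.1.eigenvalues i : ℂ)
        - a • (if a ≤ hA.1.eigenvalues i then (1 : ℂ) else 0)) * Uᴴ := by
      rw [hVV]
      refine (congrArg (fun M => M - _) hAU).trans ?_
      rw [← Matrix.smul_mul, ← Matrix.mul_smul, ← Matrix.sub_mul, ← Matrix.mul_sub,
        ← diagonal_smul, diagonal_sub]
      rfl
    rw [this]
    refine PosSemidef.mul_mul_conjTranspose_same (posSemidef_diagonal_iff.mpr fun i => ?_) U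
    split_ifs with h
    · simpa using h
    · simpa using (hA.eigenvalues_pos i).le
  set c : ℝ := 1 / (k.factorial * 2 ^ (k - 1) * N) with hc
  have hc0 : 0 ≤ c := by positivity
  have hc1 : c * (k * N) ≤ 1 := by
    have h1 : (k : ℝ) ≤ k.factorial * 2 ^ (k - 1) := by
      have h2 : (k : ℝ) ≤ k.factorial := by exact_mod_cast Nat.self_le_factorial k
      have h3 : (1 : ℝ) ≤ 2 ^ (k - 1) := one_le_pow₀ (by norm_num)
      nlinarith
    rw [hc, one_div_mul_eq_div]
    exact div_le_one_of_le₀ (by gcongr) (by positivity)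
  obtain ⟨s, hsinj, hs⟩ := aux_main V hV c hc0 hc1
  have hα : (Finset.univ.image s).card = k := by
    rw [Finset.card_image_of_injective _ hsinj]; simp
  refine ⟨Finset.univ.image s, hα, ?_⟩
  have hσ : ∀ i, ∃ t, s t = (((Finset.univ.image s).orderIsoOfFin hα) i : Fin N) := by
    intro i
    have := (((Finset.univ.image s).orderIsoOfFin hα) i).2
    obtain ⟨t, -, ht⟩ := Finset.mem_image.mp this
    exact ⟨t, ht⟩
  choose σ hσ using hσ
  have hσinj : Function.Injective σ := by
    intro i j hij
    have : (((Finset.univ.image s).orderIsoOfFin hα) i : Fin N) =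
      (((Finset.univ.image s).orderIsoOfFin hα) j : Fin N) := by rw [← hσ, ← hσ, hij]
    exact ((Finset.univ.image s).orderIsoOfFin hα).injective (Subtype.ext this)
  have key := ((hpsd.submatrix s).add (hs.smul ha.le)).submatrix σ
  convert key using 1
  have h1 : (1 : Matrix (Fin k) (Fin k) ℂ) = (1 : Matrix (Fin k) (Fin k) ℂ).submatrix σ σ :=
    (submatrix_one _ hσinj).symm
  rw [h1]
  ext i j
  simp only [← hσ, submatrix_apply, Matrix.sub_apply, Matrix.add_apply, Matrix.smul_apply,
    Matrix.mul_apply, conjTranspose_apply, id, hc, Complex.real_smul]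
  push_cast
  have h1' : (1 : Matrix (Fin k) (Fin k) ℂ) (σ (σ i)) (σ (σ j)) = (1 : Matrix (Fin k) (Fin k) ℂ) (σ i) (σ j) := by
    simp [Matrix.one_apply, hσinj.eq_iff]
  try rw [h1']
  ring
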